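/- Theorem (bringing out a bounded universal quantifier through a quantifier prefix): let f : (Fin n → Prop) → Prop respect pointwise logical equivalence, let θ : L.Formula ℕ, x : ℕ, let φ : Fin n → L.Formula ℕ each be non-dependent of x in M provided θ, and let qs : List (Bool × ℕ) be a quantifier prefix such that every variable z occurring in qs satisfies z ≠ x and is semantically non-occurring in θ. Then for every valuation v, ((∃ b : M, θ.Realize (v[x↦b])) → Q qs (fun w => f (fun i => ∀ b : M, θ.Realize (w[x↦b]) → (φ i).Realize (w[x↦b]))) v) ↔ (∀ b : M, θ.Realize (v[x↦b]) → Q qs (fun w => f (fun i => (φ i).Realize w)) (v[x↦b])). Consequently, if moreover for every valuation v there exists b : M with θ.Realize (v[x↦b]), then for every valuation v, Q qs (fun w => f (fun i => ∀ b : M, θ.Realize (w[x↦b]) → (φ i).Realize (w[x↦b]))) v ↔ (∀ b : M, θ.Realize (v[x↦b]) → Q qs (fun w => f (fun i => (φ i).Realize w)) (v[x↦b])). -/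

import Mathlib

/-- `φ` is non-dependent of variable `x` in `M` provided `θ`. -/
def NonDepProvided {L : FirstOrder.Language} (M : Type*) [L.Structure M]
    (φ θ : L.Formula ℕ) (x : ℕ) : Prop :=
  ∀ (v : ℕ → M) (b : M), θ.Realize v → θ.Realize (Function.update v x b) →
    (φ.Realize v ↔ φ.Realize (Function.update v x b))

/-- Variable `z` is semantically non-occurring in formula `χ` (in `M`). -/
def SemNonOcc {L : FirstOrder.Language} (M : Type*) [L.Structure M]
    (χ : L.Formula ℕ) (z : ℕ) : Prop :=
  ∀ (v : ℕ → M) (b : M), χ.Realize v ↔ χ.Realize (Function.update v z b)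

/-- `f` models a Boolean combination: it respects pointwise logical equivalence. -/
def RespectsIff {n : ℕ} (f : (Fin n → Prop) → Prop) : Prop :=
  ∀ P Q : Fin n → Prop, (∀ i, P i ↔ Q i) → (f P ↔ f Q)

/-- Semantic action of a quantifier prefix: `true` is `∀`, `false` is `∃`. -/
def Q {M : Type*} : List (Bool × ℕ) → ((ℕ → M) → Prop) → (ℕ → M) → Prop
  | [], P => P
  | (true, z) :: rest, P => fun v => ∀ b : M, Q rest P (Function.update v z b)
  | (false, z) :: rest, P => fun v => ∃ b : M, Q rest P (Function.update v z b)

/-- Two predicates agreeing along `w ↦ w[x↦b]` whenever `w[x↦b]` satisfies `θ` still agree after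
applying a quantifier prefix whose variables differ from `x` and do not occur in `θ`. -/
theorem Q_iff_Q_update {L : FirstOrder.Language} {M : Type*} [L.Structure M]
    {θ : L.Formula ℕ} {x : ℕ} {b : M} {P R : (ℕ → M) → Prop}
    (h : ∀ w, θ.Realize (Function.update w x b) → (P w ↔ R (Function.update w x b)))
    {qs : List (Bool × ℕ)} (hqs : ∀ p ∈ qs, p.2 ≠ x ∧ SemNonOcc M θ p.2)
    {v : ℕ → M} (hv : θ.Realize (Function.update v x b)) :
    Q qs P v ↔ Q qs R (Function.update v x b) := by
  induction qs generalizing v with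
  | nil => exact h v hv
  | cons p rest ih =>
    obtain ⟨q, z⟩ := p
    obtain ⟨hzx, hz⟩ := hqs (q, z) List.mem_cons_self
    have step (c : M) : Q rest P (Function.update v z c) ↔
        Q rest R (Function.update (Function.update v x b) z c) := by
      rw [Function.update_comm hzx.symm]
      refine ih (fun p hp => hqs p (List.mem_cons_of_mem _ hp)) ?_
      rw [Function.update_comm hzx]
      exact (hz _ c).1 hv
    cases q
    · exact exists_congr step
    · exact forall_congr' step

/-- A formula non-dependent of `x` provided `θ` is equivalent to its bounded universal
quantification over `x` at any valuation satisfying `θ`. -/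
theorem NonDepProvided.forall_realize_iff {L : FirstOrder.Language} {M : Type*} [L.Structure M]
    {φ θ : L.Formula ℕ} {x : ℕ} (hφ : NonDepProvided M φ θ x) {w : ℕ → M} {b : M}
    (hb : θ.Realize (Function.update w x b)) :
    (∀ c : M, θ.Realize (Function.update w x c) → φ.Realize (Function.update w x c)) ↔
      φ.Realize (Function.update w x b) := by
  refine ⟨fun h => h b hb, fun h c hc => ?_⟩
  have key := hφ (Function.update w x b) c hb
  rw [Function.update_idem] at key
  exact (key hc).1 h

theorem stmt12 {L : FirstOrder.Language} {M : Type*} [L.Structure M] [Nonempty M]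
    {n : ℕ} (f : (Fin n → Prop) → Prop) (hf : RespectsIff f)
    (θ : L.Formula ℕ) (x : ℕ) (φ : Fin n → L.Formula ℕ)
    (hφ : ∀ i, NonDepProvided M (φ i) θ x)
    (qs : List (Bool × ℕ))
    (hqs : ∀ p ∈ qs, p.2 ≠ x ∧ SemNonOcc M θ p.2) :
    (∀ v : ℕ → M,
      ((∃ b : M, θ.Realize (Function.update v x b)) →
          Q qs (fun w => f (fun i => ∀ b : M, θ.Realize (Function.update w x b) →
            (φ i).Realize (Function.update w x b))) v) ↔
        ∀ b : M, θ.Realize (Function.update v x b) →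
          Q qs (fun w => f (fun i => (φ i).Realize w)) (Function.update v x b)) ∧
    ((∀ v : ℕ → M, ∃ b : M, θ.Realize (Function.update v x b)) →
      ∀ v : ℕ → M,
        Q qs (fun w => f (fun i => ∀ b : M, θ.Realize (Function.update w x b) →
            (φ i).Realize (Function.update w x b))) v ↔
          ∀ b : M, θ.Realize (Function.update v x b) →
            Q qs (fun w => f (fun i => (φ i).Realize w)) (Function.update v x b)) := by
  have key (v : ℕ → M) (b : M) (hb : θ.Realize (Function.update v x b)) :
      Q qs (fun w => f (fun i => ∀ b : M, θ.Realize (Function.update w x b) →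
        (φ i).Realize (Function.update w x b))) v ↔
      Q qs (fun w => f (fun i => (φ i).Realize w)) (Function.update v x b) :=
    Q_iff_Q_update (fun _ hw => hf _ _ fun i => (hφ i).forall_realize_iff hw) hqs hb
  refine ⟨fun v => ⟨fun h b hb => (key v b hb).1 (h ⟨b, hb⟩),
    fun h ⟨b, hb⟩ => (key v b hb).2 (h b hb)⟩, fun hex v => ⟨fun h b hb => (key v b hb).1 h, ?_⟩⟩
  intro h
  obtain ⟨b, hb⟩ := hex v
  exact (key v b hb).2 (h b hb)
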